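/- Let G be a finite game structure with recurring certainty, γ : V → C an observable colouring (β^i(v) ≠ β^i(v') for every player i whenever γ(v) ≠ γ(v')), and W ⊆ C^ω an ω-regular winning condition presented by a deterministic parity automaton over C. If the grand coalition has a winning strategy profile, then it has a finite-state winning strategy profile: for each player i there is a finite-state transducer (finite set of memory states, initial memory state, memory update function reading Player i's observations in B^i, and output function into A^i) that implements a strategy s^i such that the profile (s^1,…,s^n) is winning. -/

import Mathlib

/-- The state reached after following the word `w` (a list of (action profile, state) pairs)
starting from state `v`: the last state of `w`, or `v` if `w` is empty. -/
def endFrom {α V : Type} : V → List (α × V) → V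
  | v, [] => v
  | _, p :: w => endFrom p.2 w

/-- An `n`-player game structure with imperfect information: states `V` with an initial state,
action sets `A i` for each player, a total move relation labelled by action profiles,
observation functions `obs i : V → B i` for each player, and the observation function
`obs0 : V → B0` of the fictitious, less informed Player 0, which is a coarsening of
every player's observation. -/
structure GameStructure (n : ℕ) (V : Type) (A : Fin n → Type) (B : Fin n → Type)
    (B0 : Type) where
  init : V
  move : V → (∀ i, A i) → V → Prop
  move_total : ∀ v a, ∃ v', move v a v'
  obs : ∀ i : Fin n, V → B i
  obs0 : V → B0
  obs0_coarse : ∀ v v' : V, (∃ i, obs i v = obs i v') → obs0 v = obs0 v'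

namespace GameStructure

variable {n : ℕ} {V : Type} {A : Fin n → Type} {B : Fin n → Type} {B0 : Type}

variable (G : GameStructure n V A B B0)

/-- `G.IsHistFrom v w` holds if the word `w` describes a sequence of legal moves from `v`. -/
def IsHistFrom : V → List ((∀ i, A i) × V) → Prop
  | _, [] => True
  | v, p :: w => G.move v p.1 p.2 ∧ IsHistFrom p.2 w

/-- `w` encodes a history: a legal sequence of moves from the initial state.
The history `v₀ a₀ v₁ … a_{ℓ-1} v_ℓ` is encoded as the word `(a₀,v₁) … (a_{ℓ-1},v_ℓ)`. -/
def IsHistWord (w : List ((∀ i, A i) × V)) : Prop := G.IsHistFrom G.init w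

/-- The final state of the history encoded by `w`. -/
def endState (w : List ((∀ i, A i) × V)) : V := endFrom G.init w

/-- The sequence of Player 0's observations of the states of the history encoded by `w`
(the observation of the initial state is omitted, as it is fixed). Two histories are
`∼⁰`-indistinguishable iff their `obs0Trace`s are equal (which forces equal length). -/
def obs0Trace (w : List ((∀ i, A i) × V)) : List B0 := w.map fun p => G.obs0 p.2

/-- The grand coalition attains certainty at the history `w`: every history
`∼⁰`-indistinguishable from `w` ends at the same state. -/
def Certain (w : List ((∀ i, A i) × V)) : Prop :=
  ∀ w', G.IsHistWord w' → G.obs0Trace w' = G.obs0Trace w → G.endState w' = G.endState w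

/-- A play: an infinite legal sequence of states and action profiles from the initial state. -/
structure Play (G : GameStructure n V A B B0) where
  st : ℕ → V
  act : ℕ → ∀ i, A i
  init_eq : st 0 = G.init
  valid : ∀ k, G.move (st k) (act k) (st (k + 1))

/-- The word encoding the prefix history of length `ℓ` of the play `π`. -/
def Play.prefixWord {G : GameStructure n V A B B0} (π : G.Play) (ℓ : ℕ) :
    List ((∀ i, A i) × V) :=
  (List.range ℓ).map fun k => (π.act k, π.st (k + 1))

/-- The play `π` has recurring certainty: the grand coalition attains certainty at
infinitely many of its finite prefixes. -/
def Play.HasRecurringCertainty {G : GameStructure n V A B B0} (π : G.Play) : Prop :=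
  ∀ m : ℕ, ∃ ℓ, m ≤ ℓ ∧ G.Certain (π.prefixWord ℓ)

/-- The game structure `G` has recurring certainty: every play does. -/
def RecurringCertainty : Prop := ∀ π : G.Play, π.HasRecurringCertainty

/-- `G` has periodic certainty with bound `t`: along every play, every prefix history can be
extended by at most `t` further rounds, within the play, to a history at which the grand
coalition attains certainty. -/
def PeriodicWithBound (t : ℕ) : Prop :=
  ∀ π : G.Play, ∀ m : ℕ, ∃ ℓ, m ≤ ℓ ∧ ℓ ≤ m + t ∧ G.Certain (π.prefixWord ℓ)

/-- `G` has periodic certainty: periodic certainty with some uniform bound `t`. -/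
def PeriodicCertainty : Prop := ∃ t, G.PeriodicWithBound t

end GameStructure

/-- The run of a deterministic automaton with transition function `δ` and initial state `q0`
on an infinite word `x`: `runDet δ q0 x k` is the state reached after reading `k` letters. -/
def runDet {Q σ : Type} (δ : Q → σ → Q) (q0 : Q) (x : ℕ → σ) : ℕ → Q
  | 0 => q0
  | k + 1 => δ (runDet δ q0 x k) (x k)

/-- A deterministic parity automaton over the alphabet `C` with state set `Q`: a deterministic
automaton together with a priority function. -/
structure ParityAutomaton (C Q : Type) where
  start : Q
  step : Q → C → Q
  prio : Q → ℕ

/-- The parity automaton accepts the infinite word `x` iff the least priority visited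
infinitely often along its unique run is even. -/
def ParityAutomaton.Accepts {C Q : Type} (P : ParityAutomaton C Q) (x : ℕ → C) : Prop :=
  ∃ p : ℕ, Even p ∧ {k | P.prio (runDet P.step P.start x k) = p}.Infinite ∧
    ∀ p' < p, {k | P.prio (runDet P.step P.start x k) = p'}.Finite

/-- The sequence of Player `i`'s observations of the states of the history encoded by `w`.
Two histories are `∼ⁱ`-indistinguishable iff their `obsTrace i`s are equal. -/
def GameStructure.obsTrace {n : ℕ} {V : Type} {A : Fin n → Type} {B : Fin n → Type}
    {B0 : Type} (G : GameStructure n V A B B0) (i : Fin n)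
    (w : List ((∀ j, A j) × V)) : List (B i) :=
  w.map fun p => G.obs i p.2

/-- `s` is a strategy for player `i`: it prescribes the same action at any two
`∼ⁱ`-indistinguishable histories. -/
def GameStructure.IsStrategy {n : ℕ} {V : Type} {A : Fin n → Type} {B : Fin n → Type}
    {B0 : Type} (G : GameStructure n V A B B0) (i : Fin n)
    (s : List ((∀ j, A j) × V) → A i) : Prop :=
  ∀ w w', G.IsHistWord w → G.IsHistWord w' → G.obsTrace i w = G.obsTrace i w' → s w = s w'

/-- The play `π` follows the strategy profile `s`: in every round, every player plays the
action prescribed by his strategy at the current prefix history. -/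
def GameStructure.Play.Follows {n : ℕ} {V : Type} {A : Fin n → Type} {B : Fin n → Type}
    {B0 : Type} {G : GameStructure n V A B B0} (π : G.Play)
    (s : ∀ i : Fin n, List ((∀ j, A j) × V) → A i) : Prop :=
  ∀ ℓ : ℕ, ∀ i : Fin n, π.act ℓ i = s i (π.prefixWord ℓ)

/-- The strategy profile `s` is winning: it is a profile of strategies, and the colour
sequence of every play that follows it is accepted by the parity automaton `P`. -/
def GameStructure.WinningProfile {n : ℕ} {V : Type} {A : Fin n → Type} {B : Fin n → Type}
    {B0 : Type} {C Q : Type} (G : GameStructure n V A B B0) (γ : V → C)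
    (P : ParityAutomaton C Q) (s : ∀ i : Fin n, List ((∀ j, A j) × V) → A i) : Prop :=
  (∀ i, G.IsStrategy i (s i)) ∧
  ∀ π : G.Play, π.Follows s → P.Accepts fun k => γ (π.st k)

theorem endFrom_append {α V : Type} (v : V) (u w : List (α × V)) :
    endFrom v (u ++ w) = endFrom (endFrom v u) w := by
  induction u generalizing v with
  | nil => rfl
  | cons p u ih => exact ih p.2

namespace GameStructure

section Histories

variable {n : ℕ} {V : Type} {A : Fin n → Type} {B : Fin n → Type} {B0 : Type}
variable (G : GameStructure n V A B B0)

theorem isHistFrom_append (v : V) (u w : List ((∀ i, A i) × V)) :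
    G.IsHistFrom v (u ++ w) ↔ G.IsHistFrom v u ∧ G.IsHistFrom (endFrom v u) w := by
  induction u generalizing v with
  | nil => simp [IsHistFrom, endFrom]
  | cons p u ih => simp [IsHistFrom, endFrom, ih, and_assoc]

theorem isHistWord_concat (w : List ((∀ i, A i) × V)) (p : (∀ i, A i) × V) :
    G.IsHistWord (w ++ [p]) ↔ G.IsHistWord w ∧ G.move (G.endState w) p.1 p.2 := by
  simp [IsHistWord, endState, isHistFrom_append, IsHistFrom]

@[simp]
theorem endState_concat (w : List ((∀ i, A i) × V)) (p : (∀ i, A i) × V) :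
    G.endState (w ++ [p]) = p.2 := by
  simp [endState, endFrom_append, endFrom]

variable {G}

theorem IsHistWord.of_prefix {u w : List ((∀ i, A i) × V)} (hw : G.IsHistWord w)
    (h : u <+: w) : G.IsHistWord u := by
  obtain ⟨z, rfl⟩ := h
  exact ((G.isHistFrom_append _ _ _).1 hw).1

theorem Play.prefixWord_succ (π : G.Play) (k : ℕ) :
    π.prefixWord (k + 1) = π.prefixWord k ++ [(π.act k, π.st (k + 1))] := by
  simp [Play.prefixWord, List.range_succ]

@[simp]
theorem Play.length_prefixWord (π : G.Play) (k : ℕ) : (π.prefixWord k).length = k := by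
  simp [Play.prefixWord]

@[simp]
theorem Play.endState_prefixWord (π : G.Play) (k : ℕ) :
    G.endState (π.prefixWord k) = π.st k := by
  cases k with
  | zero => exact π.init_eq.symm
  | succ k => simp [π.prefixWord_succ]

theorem Play.isHistWord_prefixWord (π : G.Play) (k : ℕ) : G.IsHistWord (π.prefixWord k) := by
  induction k with
  | zero => trivial
  | succ k ih =>
    rw [π.prefixWord_succ, isHistWord_concat]
    exact ⟨ih, by simpa using π.valid k⟩

theorem Play.take_prefixWord (π : G.Play) {m k : ℕ} (h : m ≤ k) :
    (π.prefixWord k).take m = π.prefixWord m := by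
  simp [Play.prefixWord, ← List.map_take, List.take_range, h]

/-- An ascending chain of histories of unbounded length has a play as its limit. -/
theorem exists_play_of_chain (f : ℕ → List ((∀ i, A i) × V))
    (hpre : ∀ k, f k <+: f (k + 1)) (hlen : ∀ k, k ≤ (f k).length)
    (hist : ∀ k, G.IsHistWord (f k)) :
    ∃ π : G.Play, ∀ k, π.prefixWord (f k).length = f k := by
  have hmono : ∀ a b, a ≤ b → f a <+: f b := fun a b hab => by
    induction b, hab using Nat.le_induction with
    | base => exact List.prefix_rfl
    | succ b _ ih => exact ih.trans (hpre b)
  let x : ℕ → (∀ i, A i) × V := fun k => (f (k + 1))[k]'(hlen (k + 1))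
  have hx : ∀ k j (hj : j < (f k).length), (f k)[j] = x j := fun k j hj => by
    rcases le_total k (j + 1) with h | h
    · exact (hmono _ _ h).getElem hj
    · exact ((hmono _ _ h).getElem (hlen (j + 1))).symm
  have htake : ∀ k, f k = (List.range (f k).length).map x := fun k =>
    List.ext_getElem (by simp) fun j h₁ h₂ => by simpa using hx k j h₁
  have hxh : ∀ k, G.IsHistWord ((List.range k).map x) := fun k => by
    have h := (hist k).of_prefix ((f k).take_prefix k)
    rw [htake k, ← List.map_take, List.take_range, min_eq_left (hlen k)] at h
    exact h
  let st : ℕ → V := fun k => Nat.casesOn k G.init fun k => (x k).2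
  have hst : ∀ k, G.endState ((List.range k).map x) = st k := fun k => by
    cases k with
    | zero => rfl
    | succ k => simp [List.range_succ, st]
  refine ⟨⟨st, fun k => (x k).1, rfl, fun k => ?_⟩, fun k => (htake k).symm⟩
  have h := hxh (k + 1)
  rw [List.range_succ, List.map_append, List.map_singleton, isHistWord_concat, hst] at h
  exact h.2

end Histories

section Belief

variable {n : ℕ} {V : Type} {A : Fin n → Type} {B : Fin n → Type} {B0 : Type}
variable (G : GameStructure n V A B B0)

/-- The states in which the play may be from Player 0's point of view. -/
def belief (w : List ((∀ i, A i) × V)) : Set V :=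
  {v | ∃ w', G.IsHistWord w' ∧ G.obs0Trace w' = G.obs0Trace w ∧ G.endState w' = v}

/-- The belief following the belief `K` upon the observation `b` of Player 0. -/
def nextBelief (K : Set V) (b : B0) : Set V :=
  {v' | ∃ v ∈ K, ∃ a, G.move v a v' ∧ G.obs0 v' = b}

theorem belief_nil : G.belief [] = {G.init} := by
  ext v
  constructor
  · rintro ⟨w', -, ht, rfl⟩
    obtain rfl : w' = [] := by simpa [obs0Trace] using ht
    rfl
  · rintro rfl
    exact ⟨[], trivial, rfl, rfl⟩

theorem belief_concat (w : List ((∀ i, A i) × V)) (p : (∀ i, A i) × V) :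
    G.belief (w ++ [p]) = G.nextBelief (G.belief w) (G.obs0 p.2) := by
  ext v
  constructor
  · rintro ⟨w', hw', ht, rfl⟩
    rcases List.eq_nil_or_concat' w' with rfl | ⟨u, x, rfl⟩
    · simp [obs0Trace] at ht
    · rw [isHistWord_concat] at hw'
      simp only [obs0Trace, List.map_append, List.map_singleton,
        List.append_singleton_inj] at ht
      exact ⟨_, ⟨u, hw'.1, ht.1, rfl⟩, x.1, by simpa using hw'.2, by simpa using ht.2⟩
  · rintro ⟨_, ⟨u, hu, ht, rfl⟩, a, hm, ho⟩
    refine ⟨u ++ [(a, v)], (G.isHistWord_concat _ _).2 ⟨hu, hm⟩, ?_, by simp⟩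
    simp only [obs0Trace, List.map_append, List.map_singleton] at ht ⊢
    rw [ht, ho]

variable {G}

theorem IsHistWord.endState_mem_belief {w : List ((∀ i, A i) × V)} (hw : G.IsHistWord w) :
    G.endState w ∈ G.belief w := ⟨w, hw, rfl, rfl⟩

theorem Certain.subsingleton_belief {w : List ((∀ i, A i) × V)} (hw : G.Certain w) :
    (G.belief w).Subsingleton := by
  rintro _ ⟨u, hu, ht, rfl⟩ _ ⟨u', hu', ht', rfl⟩
  rw [hw u hu ht, hw u' hu' ht']

variable (G)

/-- `G.UncertainStep x' x`: from a reachable pair `x` of a state and a belief, one round may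
lead to the pair `x'`, at which the grand coalition has no certainty. -/
def UncertainStep (x' x : V × Set V) : Prop :=
  (∃ w, G.IsHistWord w ∧ G.endState w = x.1 ∧ G.belief w = x.2) ∧
    (∃ a, G.move x.1 a x'.1) ∧ x'.2 = G.nextBelief x.2 (G.obs0 x'.1) ∧ ¬ x'.2.Subsingleton

theorem UncertainStep.wellFounded (hrec : G.RecurringCertainty) :
    WellFounded G.UncertainStep := by
  rw [wellFounded_iff_isEmpty_descending_chain]
  refine ⟨fun ⟨f, hf⟩ => ?_⟩
  obtain ⟨w, hw, hwe, hwb⟩ := (hf 0).1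
  choose a ha using fun k => (hf k).2.1
  let g : ℕ → List ((∀ i, A i) × V) := fun k =>
    Nat.rec w (fun j u => u ++ [(a j, (f (j + 1)).1)]) k
  have hg : ∀ k, g (k + 1) = g k ++ [(a k, (f (k + 1)).1)] := fun k => rfl
  have hinv : ∀ k, G.IsHistWord (g k) ∧ G.endState (g k) = (f k).1 ∧
      G.belief (g k) = (f k).2 ∧ (g k).length = w.length + k := fun k => by
    induction k with
    | zero => exact ⟨hw, hwe, hwb, rfl⟩
    | succ k ih =>
      obtain ⟨h₁, h₂, h₃, h₄⟩ := ih
      rw [hg, isHistWord_concat, endState_concat, belief_concat, h₂, h₃]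
      exact ⟨⟨h₁, ha k⟩, rfl, (hf k).2.2.1.symm, by simp [h₄, add_assoc]⟩
  obtain ⟨π, hπ⟩ := exists_play_of_chain g (fun k => ⟨_, (hg k).symm⟩)
    (fun k => by have := (hinv k).2.2.2; omega) fun k => (hinv k).1
  obtain ⟨ℓ, hℓ, hc⟩ := hrec π (w.length + 1)
  obtain ⟨k, rfl⟩ : ∃ k, ℓ = w.length + (k + 1) := ⟨ℓ - w.length - 1, by omega⟩
  rw [← (hinv (k + 1)).2.2.2, show π.prefixWord _ = _ from hπ (k + 1)] at hc
  refine (hf k).2.2.2 ?_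
  rw [← (hinv (k + 1)).2.2.1]
  exact hc.subsingleton_belief

theorem _root_.WellFounded.exists_nat_rank {X : Type} [Finite X] {r : X → X → Prop}
    (hr : WellFounded r) :
    ∃ (t : ℕ) (ρ : X → ℕ), (∀ x, ρ x ≤ t) ∧ ∀ x' x, r x' x → ρ x' < ρ x := by
  refine ⟨(Set.univ : Set X).ncard, fun x => {y | Relation.TransGen r y x}.ncard,
    fun x => Set.ncard_le_ncard (Set.subset_univ _), fun x' x h => ?_⟩
  refine Set.ncard_lt_ncard ⟨fun y hy => Relation.TransGen.tail hy h, fun hsub => ?_⟩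
  exact hr.transGen.irrefl.irrefl x' (hsub (Relation.TransGen.single h))

end Belief

end GameStructure

theorem ParityAutomaton.accepts_iff {C Q : Type} [Finite Q] (P : ParityAutomaton C Q)
    (x : ℕ → C) :
    P.Accepts x ↔ ¬ ∃ p, Odd p ∧ (∃ N, ∀ k, N ≤ k → p ≤ P.prio (runDet P.step P.start x k)) ∧
      ∀ N, ∃ k, N ≤ k ∧ P.prio (runDet P.step P.start x k) = p := by
  set c : ℕ → ℕ := fun k => P.prio (runDet P.step P.start x k) with hc
  constructor
  · rintro ⟨p, hp, hinf, hfin⟩ ⟨p', hp', ⟨N, hN⟩, hio⟩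
    obtain ⟨k, hk, hkN⟩ := hinf.exists_gt N
    have h₁ : p' ≤ p := hk ▸ hN k hkN.le
    have h₂ : p' ≠ p := by rintro rfl; exact Nat.not_even_iff_odd.2 hp' hp
    obtain ⟨M, hM⟩ := (hfin p' (by omega)).bddAbove
    obtain ⟨k, hk, hkp⟩ := hio (M + 1)
    have := hM hkp
    omega
  · intro h
    have hex : ∃ p, {k | c k = p}.Infinite := by
      obtain ⟨q, hq⟩ := Finite.exists_infinite_fiber (runDet P.step P.start x)
      refine ⟨P.prio q, (Set.infinite_coe_iff.1 hq).mono fun k hk => ?_⟩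
      exact congrArg P.prio hk
    classical
    have hmin : ∀ p' < Nat.find hex, {k | c k = p'}.Finite := fun p' hp' =>
      Set.not_infinite.1 (Nat.find_min hex hp')
    refine ⟨Nat.find hex, ?_, Nat.find_spec hex, hmin⟩
    by_contra hodd
    refine h ⟨Nat.find hex, Nat.not_even_iff_odd.1 hodd, ?_, fun N => ?_⟩
    · obtain ⟨M, hM⟩ := ((Set.finite_Iio (Nat.find hex)).biUnion hmin).bddAbove
      refine ⟨M + 1, fun k hk => ?_⟩
      by_contra! hlt
      have := hM (Set.mem_biUnion (Set.mem_Iio.2 hlt) (rfl : c k = c k))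
      omega
    · obtain ⟨k, hk, hkN⟩ := (Nat.find_spec hex).exists_gt N
      exact ⟨k, hkN.le, hk⟩

namespace GameStructure

variable {n : ℕ} {V : Type} {A : Fin n → Type} {B : Fin n → Type} {B0 : Type}
variable {C Q : Type} (G : GameStructure n V A B B0) (γ : V → C) (P : ParityAutomaton C Q)
variable (s : ∀ i : Fin n, List ((∀ j, A j) × V) → A i)

/-- The state of the automaton `P` after reading the colours of the history `w`. -/
def runState (w : List ((∀ i, A i) × V)) : Q :=
  (w.map fun p => γ p.2).foldl P.step (P.step P.start (γ G.init))

@[simp]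
theorem runState_concat (w : List ((∀ i, A i) × V)) (p : (∀ i, A i) × V) :
    G.runState γ P (w ++ [p]) = P.step (G.runState γ P w) (γ p.2) := by
  simp [runState]

variable {G} in
theorem Play.runState_prefixWord (π : G.Play) (k : ℕ) :
    G.runState γ P (π.prefixWord k) =
      runDet P.step P.start (fun j => γ (π.st j)) (k + 1) := by
  induction k with
  | zero => simp [runDet, π.init_eq, runState, Play.prefixWord]
  | succ k ih =>
    rw [π.prefixWord_succ, runState_concat, ih]
    rfl

/-- `w` is a history that follows the strategy profile `s`. -/
def Consistent (w : List ((∀ i, A i) × V)) : Prop :=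
  G.IsHistWord w ∧ ∀ u p, u ++ [p] <+: w → ∀ i, p.1 i = s i u

theorem consistent_nil : G.Consistent s [] :=
  ⟨trivial, fun u p h => by simp at h⟩

variable {G s}

theorem Consistent.concat {w : List ((∀ i, A i) × V)} (hw : G.Consistent s w)
    {p : (∀ i, A i) × V} (hm : G.move (G.endState w) p.1 p.2) (hs : ∀ i, p.1 i = s i w) :
    G.Consistent s (w ++ [p]) := by
  refine ⟨(G.isHistWord_concat _ _).2 ⟨hw.1, hm⟩, fun u x h => ?_⟩
  rcases List.prefix_concat_iff.1 h with h | h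
  · obtain ⟨rfl, rfl⟩ := List.append_singleton_inj.1 h
    exact hs
  · exact hw.2 u x h

variable (G s)

/-- `w'` is a consistent history extending `w` along which, from `w` on, no priority less than
`p` occurs and the priority `p` does occur. -/
def Regress (p : ℕ) (w' w : List ((∀ i, A i) × V)) : Prop :=
  w <+: w' ∧ G.Consistent s w' ∧
    (∀ k, w.length ≤ k → k < w'.length → p ≤ P.prio (G.runState γ P (w'.take k))) ∧
    ∃ k, w.length ≤ k ∧ k < w'.length ∧ P.prio (G.runState γ P (w'.take k)) = p

variable {G γ P s}

theorem Regress.of_concat {p : ℕ} {w y : List ((∀ i, A i) × V)} {x : (∀ i, A i) × V}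
    (h : G.Regress γ P s p y (w ++ [x])) (hp : p ≤ P.prio (G.runState γ P w)) :
    G.Regress γ P s p y w := by
  obtain ⟨hpre, hc, hge, k, hk, hky, hkp⟩ := h
  have hwy : w <+: y := (List.prefix_append _ _).trans hpre
  simp only [List.length_append, List.length_singleton] at hge hk
  refine ⟨hwy, hc, fun j hj hjy => ?_, k, by omega, hky, hkp⟩
  rcases hj.eq_or_lt with rfl | hj
  · rwa [← List.prefix_iff_eq_take.1 hwy]
  · exact hge j hj hjy

theorem Consistent.regress_concat {w : List ((∀ i, A i) × V)} {x : (∀ i, A i) × V}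
    (h : G.Consistent s (w ++ [x])) :
    G.Regress γ P s (P.prio (G.runState γ P w)) (w ++ [x]) w := by
  refine ⟨List.prefix_append _ _, h, fun k hk hk' => ?_, w.length, le_rfl, by simp, by simp⟩
  obtain rfl : k = w.length := by
    simp only [List.length_append, List.length_singleton] at hk'
    omega
  simp

theorem Regress.wellFounded [Finite Q] (hs : G.WinningProfile γ P s) {p : ℕ} (hp : Odd p) :
    WellFounded (G.Regress γ P s p) := by
  rw [wellFounded_iff_isEmpty_descending_chain]
  refine ⟨fun ⟨f, hf⟩ => ?_⟩
  have hlt : ∀ k, (f k).length < (f (k + 1)).length := fun k => by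
    obtain ⟨j, h₁, h₂, -⟩ := (hf k).2.2.2
    omega
  have hlen : ∀ k, k ≤ (f k).length := fun k => by
    induction k with
    | zero => omega
    | succ k ih => have := hlt k; omega
  have hlen' : ∀ k, k < (f (k + 1)).length := fun k => hlen (k + 1)
  obtain ⟨π, hπ⟩ := exists_play_of_chain (fun k => f (k + 1)) (fun k => (hf (k + 1)).1)
    (fun k => (hlen' k).le) fun k => (hf k).2.1.1
  have htake : ∀ k m, m ≤ (f (k + 1)).length → (f (k + 1)).take m = π.prefixWord m :=
    fun k m hm => by rw [← hπ k, π.take_prefixWord hm]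
  have hfol : π.Follows s := fun ℓ i => by
    refine (hf ℓ).2.1.2 (π.prefixWord ℓ) (π.act ℓ, π.st (ℓ + 1)) ?_ i
    rw [← π.prefixWord_succ, ← htake ℓ (ℓ + 1) (hlen' ℓ)]
    exact List.take_prefix _ _
  refine (P.accepts_iff _).1 (hs.2 π hfol) ⟨p, hp, ⟨(f 0).length + 1, fun k hk => ?_⟩,
    fun N => ?_⟩
  · obtain ⟨k, rfl⟩ : ∃ j, k = j + 1 := ⟨k - 1, by omega⟩
    rw [← π.runState_prefixWord]
    have key : ∀ m j, (f 0).length ≤ j → j < (f m).length →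
        p ≤ P.prio (G.runState γ P (π.prefixWord j)) := fun m => by
      induction m with
      | zero => intro j h₁ h₂; omega
      | succ m ih =>
        intro j h₁ h₂
        rcases lt_or_ge j (f m).length with h | h
        · exact ih j h₁ h
        · rw [← htake m j h₂.le]
          exact (hf m).2.2.1 j h h₂
    exact key (k + 1) k (by omega) (hlen' k)
  · obtain ⟨k, h₁, h₂, h₃⟩ := (hf N).2.2.2
    refine ⟨k + 1, by have := hlen N; omega, ?_⟩
    rw [← π.runState_prefixWord, ← htake N k h₂.le, h₃]

variable (G γ P s)

open Classical in
/-- The signature of a history: its rank with respect to `Regress p`, for each `p < d` for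
which this relation is well-founded. -/
noncomputable def signature (d : ℕ) (w : List ((∀ i, A i) × V)) (p : Fin d) : Ordinal.{0} :=
  if h : WellFounded (G.Regress γ P s p) then (h.apply w).rank else 0

variable {G γ P s}

theorem signature_concat_le {d : ℕ} {p : Fin d} {w : List ((∀ i, A i) × V)}
    {x : (∀ i, A i) × V} (hp : p ≤ P.prio (G.runState γ P w)) :
    G.signature γ P s d (w ++ [x]) p ≤ G.signature γ P s d w p := by
  unfold signature
  split_ifs with h
  · rw [Acc.rank_eq]
    refine Ordinal.iSup_le fun y => ?_
    exact Order.succ_le_of_lt ((h.apply w).rank_lt_of_rel (y.2.of_concat hp))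
  · exact le_rfl

theorem signature_concat_lt [Finite Q] (hs : G.WinningProfile γ P s) {d : ℕ} {p : Fin d}
    (hodd : Odd (p : ℕ)) {w : List ((∀ i, A i) × V)} {x : (∀ i, A i) × V}
    (h : G.Consistent s (w ++ [x])) (hp : P.prio (G.runState γ P w) = p) :
    G.signature γ P s d (w ++ [x]) p < G.signature γ P s d w p := by
  have hwf := Regress.wellFounded hs hodd
  unfold signature
  rw [dif_pos hwf, dif_pos hwf]
  exact (hwf.apply w).rank_lt_of_rel (hp ▸ h.regress_concat)

/-- The truncation of a tuple of ordinals to the components up to `p`. -/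
noncomputable def truncate {d : ℕ} (p : Fin d) (x : Fin d → Ordinal.{0}) : Fin d → Ordinal.{0} :=
  fun j => if j ≤ p then x j else 0

theorem toLex_truncate_mono {d : ℕ} (p : Fin d) {x y : Fin d → Ordinal.{0}}
    (h : toLex x ≤ toLex y) : toLex (truncate p x) ≤ toLex (truncate p y) := by
  rcases h.eq_or_lt with h | ⟨j, hj, hlt⟩
  · rw [toLex_inj.1 h]
  · by_cases hjp : j ≤ p
    · refine le_of_lt ⟨j, fun k hk => ?_, ?_⟩
      · simpa [truncate, hk.le.trans hjp] using hj k hk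
      · simpa [truncate, hjp] using hlt
    · refine le_of_eq (congrArg toLex (funext fun k => ?_))
      by_cases hk : k ≤ p
      · simpa [truncate, hk] using hj k (hk.trans_lt (not_le.1 hjp))
      · simp [truncate, hk]

/-- A memory state of a player: the current belief of Player 0 and automaton state, their
values at the last moment of certainty, and the observations received since then. -/
abbrev Memory (V Q β : Type) (t : ℕ) : Type :=
  (Set V × Q) × (Set V × Q) × {l : List β // l.length ≤ t}

variable (G P)

open Classical in
/-- The memory update upon an observation `b`, which determines Player 0's observation `f b`
and the colour `g b`. -/
noncomputable def updateMemory {β : Type} {t : ℕ} (f : β → B0) (g : β → C)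
    (m : Memory V Q β t) (b : β) : Memory V Q β t :=
  let κ := (G.nextBelief m.1.1 (f b), P.step m.1.2 (g b))
  if κ.1.Subsingleton then (κ, κ, ⟨[], Nat.zero_le t⟩)
  else (κ, m.2.1, ⟨(m.2.2.1 ++ [b]).take t, by simp⟩)

variable {G P}

theorem updateMemory_of_subsingleton {β : Type} {t : ℕ} {f : β → B0} {g : β → C}
    {m : Memory V Q β t} {b : β} (h : (G.nextBelief m.1.1 (f b)).Subsingleton) :
    G.updateMemory P f g m b = ((G.nextBelief m.1.1 (f b), P.step m.1.2 (g b)),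
      (G.nextBelief m.1.1 (f b), P.step m.1.2 (g b)), ⟨[], Nat.zero_le t⟩) :=
  if_pos h

theorem updateMemory_of_not_subsingleton {β : Type} {t : ℕ} {f : β → B0} {g : β → C}
    {m : Memory V Q β t} {b : β} (h : ¬ (G.nextBelief m.1.1 (f b)).Subsingleton) :
    G.updateMemory P f g m b = ((G.nextBelief m.1.1 (f b), P.step m.1.2 (g b)),
      m.2.1, ⟨(m.2.2.1 ++ [b]).take t, by simp⟩) :=
  if_neg h

variable (G P γ)

/-- The initial value of the information common to all players. -/
def initialKey : Set V × Q := ({G.init}, P.step P.start (γ G.init))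

/-- The update of the optional memory, where `none` is the memory before the initial state is
observed. -/
noncomputable def updateOption {β : Type} {t : ℕ} (f : β → B0) (g : β → C) :
    Option (Memory V Q β t) → β → Option (Memory V Q β t)
  | none, _ => some (G.initialKey γ P, G.initialKey γ P, ⟨[], Nat.zero_le t⟩)
  | some m, b => some (G.updateMemory P f g m b)

/-- The memory state of a player with observation function `o` after the history `w`. -/
noncomputable def memoryAfter {β : Type} (t : ℕ) (f : β → B0) (g : β → C) (o : V → β)
    (w : List ((∀ i, A i) × V)) : Option (Memory V Q β t) :=
  ((G.init :: w.map Prod.snd).map o).foldl (G.updateOption γ P f g) none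

variable {G} in
open Classical in
/-- The belief and automaton state at the last moment of certainty before round `k`, together
with the part of the play since then. -/
noncomputable def Play.segment (π : G.Play) :
    ℕ → (Set V × Q) × List ((∀ i, A i) × V)
  | 0 => (G.initialKey γ P, [])
  | k + 1 =>
    if (G.belief (π.prefixWord (k + 1))).Subsingleton then
      ((G.belief (π.prefixWord (k + 1)), G.runState γ P (π.prefixWord (k + 1))), [])
    else ((Play.segment π k).1, (Play.segment π k).2 ++ [(π.act k, π.st (k + 1))])

variable {G γ P}

theorem Play.length_segment_add_le (π : G.Play) {t : ℕ} {ρ : V × Set V → ℕ}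
    (hρt : ∀ x, ρ x ≤ t) (hρ : ∀ x' x, G.UncertainStep x' x → ρ x' < ρ x) (k : ℕ) :
    (π.segment γ P k).2.length + ρ (π.st k, G.belief (π.prefixWord k)) ≤ t := by
  induction k with
  | zero => simpa [segment] using hρt _
  | succ k ih =>
    rw [segment]
    split_ifs with h
    · simpa using hρt _
    · have := hρ (π.st (k + 1), G.belief (π.prefixWord (k + 1)))
        (π.st k, G.belief (π.prefixWord k))
        ⟨⟨_, π.isHistWord_prefixWord k, by simp, rfl⟩, ⟨_, π.valid k⟩,
          by rw [π.prefixWord_succ, belief_concat], h⟩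
      simp only [List.length_append, List.length_singleton]
      omega

theorem Play.memoryAfter_prefixWord (π : G.Play) {β : Type} {t : ℕ} {f : β → B0} {g : β → C}
    {o : V → β} (hf : ∀ v, f (o v) = G.obs0 v) (hg : ∀ v, g (o v) = γ v)
    (ht : ∀ k, (π.segment γ P k).2.length ≤ t) (k : ℕ) :
    G.memoryAfter γ P t f g o (π.prefixWord k) =
      some ((G.belief (π.prefixWord k), G.runState γ P (π.prefixWord k)),
        (π.segment γ P k).1,
        ⟨(π.segment γ P k).2.map fun p => o p.2, by simpa using ht k⟩) := by
  induction k with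
  | zero =>
    simp [memoryAfter, Play.prefixWord, updateOption, segment, belief_nil, initialKey, runState]
  | succ k ih =>
    have hstep : G.memoryAfter γ P t f g o (π.prefixWord (k + 1)) =
        G.updateOption γ P f g (G.memoryAfter γ P t f g o (π.prefixWord k))
          (o (π.st (k + 1))) := by
      simp [memoryAfter, π.prefixWord_succ]
    have hb : G.nextBelief (G.belief (π.prefixWord k)) (f (o (π.st (k + 1)))) =
        G.belief (π.prefixWord (k + 1)) := by
      rw [hf, π.prefixWord_succ, belief_concat]
    have hr : P.step (G.runState γ P (π.prefixWord k)) (g (o (π.st (k + 1)))) =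
        G.runState γ P (π.prefixWord (k + 1)) := by
      rw [hg, π.prefixWord_succ, runState_concat]
    rw [hstep, ih]
    by_cases h : (G.belief (π.prefixWord (k + 1))).Subsingleton
    · have hseg : π.segment γ P (k + 1) =
          ((G.belief (π.prefixWord (k + 1)), G.runState γ P (π.prefixWord (k + 1))), []) :=
        if_pos h
      rw [updateOption, updateMemory_of_subsingleton (by rwa [hb])]
      simp [hb, hr, hseg]
    · have hseg : π.segment γ P (k + 1) =
          ((π.segment γ P k).1, (π.segment γ P k).2 ++ [(π.act k, π.st (k + 1))]) :=
        if_neg h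
      have hlen := ht (k + 1)
      rw [hseg] at hlen
      rw [updateOption, updateMemory_of_not_subsingleton (by rwa [hb])]
      simp only [hb, hr, hseg, List.map_append, List.map_singleton]
      congr 4
      exact List.take_of_length_le (by simpa using hlen)

variable (G γ P s)

/-- `w` is a consistent history whose last state and automaton state are compatible with `κ`. -/
def Represents (κ : Set V × Q) (w : List ((∀ i, A i) × V)) : Prop :=
  G.Consistent s w ∧ G.endState w ∈ κ.1 ∧ G.runState γ P w = κ.2

theorem exists_minimal_representative (d : ℕ) (κ : Set V × Q) :
    ∃ r, ∀ w, G.Represents γ P s κ w → G.Represents γ P s κ r ∧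
      toLex (G.signature γ P s d r) ≤ toLex (G.signature γ P s d w) := by
  by_cases hne : ∃ w, G.Represents γ P s κ w
  · obtain ⟨r, hr, hmin⟩ := (InvImage.wf (fun w => toLex (G.signature γ P s d w))
      wellFounded_lt).has_min {w | G.Represents γ P s κ w} hne
    exact ⟨r, fun w hw => ⟨hr, not_lt.1 (hmin w hw)⟩⟩
  · exact ⟨[], fun w hw => (hne ⟨w, hw⟩).elim⟩

open Classical in
/-- The action of player `i` in a given memory state: he plays as `s` prescribes after some
history that consists of the chosen representative of the last moment of certainty followed by
a word that agrees with his observations since then. -/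
noncomputable def outputAction [∀ i, Nonempty (A i)] (rep : Set V × Q → List ((∀ i, A i) × V))
    (t : ℕ) (i : Fin n) : Option (Memory V Q (B i) t) → A i
  | none => Classical.arbitrary _
  | some m =>
    if h : ∃ l, G.IsHistWord (rep m.2.1 ++ l) ∧ G.obsTrace i l = m.2.2.1 then
      s i (rep m.2.1 ++ h.choose)
    else Classical.arbitrary _

variable {G s}

theorem outputAction_eq [∀ i, Nonempty (A i)] {rep : Set V × Q → List ((∀ i, A i) × V)}
    {t : ℕ} {i : Fin n} (hs : G.IsStrategy i (s i)) {m : Memory V Q (B i) t}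
    {l : List ((∀ i, A i) × V)} (hl : G.IsHistWord (rep m.2.1 ++ l))
    (hm : G.obsTrace i l = m.2.2.1) :
    G.outputAction s rep t i (some m) = s i (rep m.2.1 ++ l) := by
  have h : ∃ l, G.IsHistWord (rep m.2.1 ++ l) ∧ G.obsTrace i l = m.2.2.1 := ⟨l, hl, hm⟩
  rw [outputAction, dif_pos h]
  refine hs _ _ h.choose_spec.1 hl ?_
  have := h.choose_spec.2.trans hm.symm
  simp only [obsTrace, List.map_append] at this ⊢
  rw [this]

variable {γ P}

/-- If the actions of a play are those that `s` prescribes after the representative of the last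
moment of certainty followed by the part of the play since then, the play is won. -/
theorem Play.accepts_of_act_eq [Finite Q] (hs : G.WinningProfile γ P s) (π : G.Play) {d : ℕ}
    (hd : ∀ q, P.prio q < d) {rep : Set V × Q → List ((∀ i, A i) × V)}
    (hrep : ∀ κ w, G.Represents γ P s κ w → G.Represents γ P s κ (rep κ) ∧
      toLex (G.signature γ P s d (rep κ)) ≤ toLex (G.signature γ P s d w))
    (hact : ∀ k i, G.IsHistWord (rep (π.segment γ P k).1 ++ (π.segment γ P k).2) →
      π.act k i = s i (rep (π.segment γ P k).1 ++ (π.segment γ P k).2)) :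
    P.Accepts fun k => γ (π.st k) := by
  let h : ℕ → List ((∀ i, A i) × V) := fun k =>
    rep (π.segment γ P k).1 ++ (π.segment γ P k).2
  let h' : ℕ → List ((∀ i, A i) × V) := fun k => h k ++ [(π.act k, π.st (k + 1))]
  have hnext : ∀ k, (G.Consistent s (h k) ∧ G.endState (h k) = π.st k ∧
      G.runState γ P (h k) = G.runState γ P (π.prefixWord k)) →
      (G.Consistent s (h' k) ∧ G.runState γ P (h' k) = G.runState γ P (π.prefixWord (k + 1))) ∧
      (G.Consistent s (h (k + 1)) ∧ G.endState (h (k + 1)) = π.st (k + 1) ∧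
        G.runState γ P (h (k + 1)) = G.runState γ P (π.prefixWord (k + 1))) ∧
      toLex (G.signature γ P s d (h (k + 1))) ≤ toLex (G.signature γ P s d (h' k)) := by
    rintro k ⟨hc, he, hr⟩
    have hc' : G.Consistent s (h' k) :=
      hc.concat (by rw [he]; exact π.valid k) fun i => hact k i hc.1
    have hr' : G.runState γ P (h' k) = G.runState γ P (π.prefixWord (k + 1)) := by
      rw [π.prefixWord_succ, runState_concat, runState_concat, hr]
    refine ⟨⟨hc', hr'⟩, ?_⟩
    have hmem : π.st (k + 1) ∈ G.belief (π.prefixWord (k + 1)) := by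
      simpa using (π.isHistWord_prefixWord (k + 1)).endState_mem_belief
    by_cases hsub : (G.belief (π.prefixWord (k + 1))).Subsingleton
    · obtain ⟨⟨h₁, h₂, h₃⟩, h₄⟩ := hrep
        (G.belief (π.prefixWord (k + 1)), G.runState γ P (π.prefixWord (k + 1))) (h' k)
        ⟨hc', by simpa [h'] using hmem, hr'⟩
      have hk : h (k + 1) = rep
          (G.belief (π.prefixWord (k + 1)), G.runState γ P (π.prefixWord (k + 1))) := by
        simp [h, segment, hsub]
      rw [hk]
      exact ⟨⟨h₁, hsub h₂ hmem, h₃⟩, h₄⟩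
    · have hk : h (k + 1) = h' k := by simp [h, h', segment, hsub]
      rw [hk]
      exact ⟨⟨hc', by simp [h'], hr'⟩, le_rfl⟩
  have hinv : ∀ k, G.Consistent s (h k) ∧ G.endState (h k) = π.st k ∧
      G.runState γ P (h k) = G.runState γ P (π.prefixWord k) := fun k => by
    induction k with
    | zero =>
      obtain ⟨⟨h₁, h₂, h₃⟩, -⟩ := hrep (G.initialKey γ P) []
        ⟨G.consistent_nil s, rfl, rfl⟩
      have hk : h 0 = rep (G.initialKey γ P) := by simp [h, segment]
      rw [hk]
      exact ⟨h₁, h₂.trans π.init_eq.symm, h₃⟩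
    | succ k ih => exact (hnext k ih).2.1
  rw [P.accepts_iff]
  rintro ⟨p, hodd, ⟨N, hN⟩, hio⟩
  have hpd : p < d := by
    obtain ⟨k, -, rfl⟩ := hio 0
    exact hd _
  let p' : Fin d := ⟨p, hpd⟩
  let a : ℕ → Lex (Fin d → Ordinal.{0}) := fun k =>
    toLex (truncate p' (G.signature γ P s d (h k)))
  have hle : ∀ k, a (k + 1) ≤ toLex (truncate p' (G.signature γ P s d (h' k))) := fun k =>
    toLex_truncate_mono p' (hnext k (hinv k)).2.2
  have hpr : ∀ k, P.prio (G.runState γ P (h k)) =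
      P.prio (runDet P.step P.start (fun j => γ (π.st j)) (k + 1)) := fun k => by
    rw [(hinv k).2.2, π.runState_prefixWord]
  have htr : ∀ k, N ≤ k → truncate p' (G.signature γ P s d (h' k)) ≤
      truncate p' (G.signature γ P s d (h k)) := fun k hk j => by
    by_cases hj : j ≤ p'
    · have : p ≤ P.prio (G.runState γ P (h k)) := hpr k ▸ hN (k + 1) (by omega)
      simpa [truncate, hj] using signature_concat_le (le_trans (Fin.le_def.1 hj) this)
    · simp [truncate, hj]
  have hanti : ∀ k l, N ≤ k → k ≤ l → a l ≤ a k := fun k l hk hkl => by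
    induction l, hkl using Nat.le_induction with
    | base => exact le_rfl
    | succ l hl ih => exact ((hle l).trans (Pi.toLex_monotone (htr l (hk.trans hl)))).trans ih
  obtain ⟨k, hk, hmin⟩ := (InvImage.wf a wellFounded_lt).has_min (Set.Ici N) ⟨N, Set.self_mem_Ici⟩
  obtain ⟨l, hl, hlp⟩ := hio (k + 1)
  obtain ⟨l, rfl⟩ : ∃ j, l = j + 1 := ⟨l - 1, by omega⟩
  have hkl : k ≤ l := by omega
  have hk : N ≤ k := hk
  refine hmin (l + 1) (show N ≤ l + 1 by omega) ?_
  refine ((hle l).trans_lt (Pi.toLex_strictMono ?_)).trans_le (hanti k l hk hkl)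
  refine Pi.lt_def.2 ⟨htr l (hk.trans hkl), p', ?_⟩
  simpa [truncate] using
    signature_concat_lt (p := p') hs hodd (hnext l (hinv l)).1.1 ((hpr l).trans hlp)

end GameStructure

/-- Finite-state strategy synthesis for games with recurring certainty: if the grand coalition
has a winning strategy profile for an observable ω-regular (parity) winning condition, then it
has one in which each player's strategy is implemented by a finite-state transducer reading
that player's observations. -/
theorem finite_state_winning_profile_of_winning_profile
    {n : ℕ} {V : Type} {A : Fin n → Type} {B : Fin n → Type} {B0 : Type}
    (hn : 1 ≤ n) [Fintype V] [∀ i, Fintype (A i)] [∀ i, Nonempty (A i)]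
    [∀ i, Fintype (B i)] [Fintype B0]
    (G : GameStructure n V A B B0)
    {C Q : Type} [Fintype C] [Fintype Q] (γ : V → C)
    (hγ : ∀ v v' : V, γ v ≠ γ v' → ∀ i, G.obs i v ≠ G.obs i v')
    (P : ParityAutomaton C Q)
    (hrec : G.RecurringCertainty)
    (hwin : ∃ s : ∀ i : Fin n, List ((∀ j, A j) × V) → A i, G.WinningProfile γ P s) :
    ∃ s : ∀ i : Fin n, List ((∀ j, A j) × V) → A i,
      G.WinningProfile γ P s ∧
      ∀ i : Fin n, ∃ (M : Type) (_ : Fintype M) (m0 : M) (upd : M → B i → M)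
        (out : M → A i),
        ∀ w : List ((∀ j, A j) × V), G.IsHistWord w →
          s i w = out (((G.init :: w.map Prod.snd).map (G.obs i)).foldl upd m0) := by
  obtain ⟨s, hs⟩ := hwin
  obtain ⟨t, ρ, hρt, hρ⟩ := (GameStructure.UncertainStep.wellFounded G hrec).exists_nat_rank
  obtain ⟨d, hd⟩ : ∃ d, ∀ q, P.prio q < d := by
    obtain ⟨M, hM⟩ := (Set.finite_range P.prio).bddAbove
    exact ⟨M + 1, fun q => Nat.lt_succ_of_le (hM ⟨q, rfl⟩)⟩
  choose rep hrep using G.exists_minimal_representative γ P s d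
  have hf : ∀ i, ∃ f : B i → B0, ∀ v, f (G.obs i v) = G.obs0 v := fun i => by
    have : Function.FactorsThrough G.obs0 (G.obs i) := fun v v' h =>
      G.obs0_coarse v v' ⟨i, h⟩
    exact ⟨Function.extend (G.obs i) G.obs0 fun _ => G.obs0 G.init,
      fun v => this.extend_apply _ v⟩
  have hg : ∀ i, ∃ g : B i → C, ∀ v, g (G.obs i v) = γ v := fun i => by
    have : Function.FactorsThrough γ (G.obs i) := fun v v' h => by
      by_contra hne
      exact hγ v v' hne i h
    exact ⟨Function.extend (G.obs i) γ fun _ => γ G.init, fun v => this.extend_apply _ v⟩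
  choose f hf using hf
  choose g hg using hg
  refine ⟨fun i w => G.outputAction s rep t i (G.memoryAfter γ P t (f i) (g i) (G.obs i) w),
    ⟨fun i w w' _ _ h => ?_, fun π hπ => ?_⟩, fun i => ?_⟩
  · have h' : (w.map Prod.snd).map (G.obs i) = (w'.map Prod.snd).map (G.obs i) := by
      simpa [GameStructure.obsTrace, Function.comp_def] using h
    simp only [GameStructure.memoryAfter, List.map_cons, h']
  · refine π.accepts_of_act_eq hs hd hrep fun k i hist => ?_
    rw [hπ k i]
    beta_reduce
    rw [π.memoryAfter_prefixWord (hf i) (hg i)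
      fun k => (Nat.le_add_right _ _).trans (π.length_segment_add_le hρt hρ k)]
    exact GameStructure.outputAction_eq (hs.1 i) hist rfl
  · have : Finite {l : List (B i) // l.length ≤ t} :=
      (List.finite_length_le (B i) t).to_subtype
    exact ⟨Option (GameStructure.Memory V Q (B i) t), Fintype.ofFinite _, none,
      G.updateOption γ P (f i) (g i), G.outputAction s rep t i, fun w _ => rfl⟩
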